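/- (Lemma 4.2) Conjugate directions are invariant under the tangent map of the inversion if and only if η vanishes or the directions are perpendicular: let (a₁,b₁) and (a₂,b₂) be nonzero pairs of reals representing the tangent vectors w_i = a_i x_u + b_i x_v at a point (u₀,v₀), and suppose they are conjugate for x, i.e. e a₁a₂ + f(a₁b₂ + a₂b₁) + g b₁b₂ = 0 at (u₀,v₀). Then the corresponding vectors a_i y_u + b_i y_v are conjugate for y, i.e. ẽ a₁a₂ + f̃(a₁b₂ + a₂b₁) + g̃ b₁b₂ = 0 at (u₀,v₀), if and only if η(u₀,v₀) = 0 or ⟨w₁, w₂⟩ = E a₁a₂ + F(a₁b₂ + a₂b₁) + G b₁b₂ = 0 at (u₀,v₀). -/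

import Mathlib

noncomputable section
open scoped RealInnerProductSpace

/-- ℝ³ as Euclidean 3-space. -/
abbrev E3 : Type := EuclideanSpace ℝ (Fin 3)

/-- The cross product on ℝ³. -/
def cross (a b : E3) : E3 :=
  (WithLp.equiv 2 (Fin 3 → ℝ)).symm
    ![a 1 * b 2 - a 2 * b 1, a 2 * b 0 - a 0 * b 2, a 0 * b 1 - a 1 * b 0]

/-- The inversion of ℝ³ with center `c` and radius `r`. -/
def inv3 (c : E3) (r : ℝ) (p : E3) : E3 :=
  c + (r ^ 2 / ‖p - c‖ ^ 2) • (p - c)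

/-- Partial derivative in the first variable. -/
def pu {E : Type*} [NormedAddCommGroup E] [NormedSpace ℝ E]
    (x : ℝ → ℝ → E) (u v : ℝ) : E :=
  deriv (fun t => x t v) u

/-- Partial derivative in the second variable. -/
def pv {E : Type*} [NormedAddCommGroup E] [NormedSpace ℝ E]
    (x : ℝ → ℝ → E) (u v : ℝ) : E :=
  deriv (fun t => x u t) v

/-- The unit normal of a patch. -/
def unormal (x : ℝ → ℝ → E3) (u v : ℝ) : E3 :=
  ‖cross (pu x u v) (pv x u v)‖⁻¹ • cross (pu x u v) (pv x u v)

/-- The conformal factor λ of the inversion along the patch. -/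
def lam (c : E3) (r : ℝ) (x : ℝ → ℝ → E3) (u v : ℝ) : ℝ :=
  r ^ 2 / ‖x u v - c‖ ^ 2

/-- The support-type function η = ⟨U_x, x − c⟩. -/
def eta (c : E3) (x : ℝ → ℝ → E3) (u v : ℝ) : ℝ :=
  ⟪unormal x u v, x u v - c⟫

/-- First fundamental form coefficient E. -/
def FFE (x : ℝ → ℝ → E3) (u v : ℝ) : ℝ := ⟪pu x u v, pu x u v⟫
/-- First fundamental form coefficient F. -/
def FFF (x : ℝ → ℝ → E3) (u v : ℝ) : ℝ := ⟪pu x u v, pv x u v⟫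
/-- First fundamental form coefficient G. -/
def FFG (x : ℝ → ℝ → E3) (u v : ℝ) : ℝ := ⟪pv x u v, pv x u v⟫
/-- Second fundamental form coefficient e. -/
def SFe (x : ℝ → ℝ → E3) (u v : ℝ) : ℝ := ⟪pu (pu x) u v, unormal x u v⟫
/-- Second fundamental form coefficient f. -/
def SFf (x : ℝ → ℝ → E3) (u v : ℝ) : ℝ := ⟪pv (pu x) u v, unormal x u v⟫
/-- Second fundamental form coefficient g. -/
def SFg (x : ℝ → ℝ → E3) (u v : ℝ) : ℝ := ⟪pv (pv x) u v, unormal x u v⟫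
/-- Third fundamental form coefficient P. -/
def TFP (x : ℝ → ℝ → E3) (u v : ℝ) : ℝ := ⟪pu (unormal x) u v, pu (unormal x) u v⟫
/-- Third fundamental form coefficient Q. -/
def TFQ (x : ℝ → ℝ → E3) (u v : ℝ) : ℝ := ⟪pu (unormal x) u v, pv (unormal x) u v⟫
/-- Third fundamental form coefficient R. -/
def TFR (x : ℝ → ℝ → E3) (u v : ℝ) : ℝ := ⟪pv (unormal x) u v, pv (unormal x) u v⟫

/-- Christoffel symbol Γ¹₁₁. -/
def Ch111 (x : ℝ → ℝ → E3) (u v : ℝ) : ℝ :=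
  (FFG x u v * pu (FFE x) u v - 2 * FFF x u v * pu (FFF x) u v + FFF x u v * pv (FFE x) u v) /
    (2 * (FFE x u v * FFG x u v - FFF x u v ^ 2))
/-- Christoffel symbol Γ²₁₁. -/
def Ch211 (x : ℝ → ℝ → E3) (u v : ℝ) : ℝ :=
  (2 * FFE x u v * pu (FFF x) u v - FFE x u v * pv (FFE x) u v - FFF x u v * pu (FFE x) u v) /
    (2 * (FFE x u v * FFG x u v - FFF x u v ^ 2))
/-- Christoffel symbol Γ¹₁₂. -/
def Ch112 (x : ℝ → ℝ → E3) (u v : ℝ) : ℝ :=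
  (FFG x u v * pv (FFE x) u v - FFF x u v * pu (FFG x) u v) /
    (2 * (FFE x u v * FFG x u v - FFF x u v ^ 2))
/-- Christoffel symbol Γ²₁₂. -/
def Ch212 (x : ℝ → ℝ → E3) (u v : ℝ) : ℝ :=
  (FFE x u v * pu (FFG x) u v - FFF x u v * pv (FFE x) u v) /
    (2 * (FFE x u v * FFG x u v - FFF x u v ^ 2))
/-- Christoffel symbol Γ¹₂₂. -/
def Ch122 (x : ℝ → ℝ → E3) (u v : ℝ) : ℝ :=
  (2 * FFG x u v * pv (FFF x) u v - FFG x u v * pu (FFG x) u v - FFF x u v * pv (FFG x) u v) /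
    (2 * (FFE x u v * FFG x u v - FFF x u v ^ 2))
/-- Christoffel symbol Γ²₂₂. -/
def Ch222 (x : ℝ → ℝ → E3) (u v : ℝ) : ℝ :=
  (FFE x u v * pv (FFG x) u v - 2 * FFF x u v * pv (FFF x) u v + FFF x u v * pu (FFG x) u v) /
    (2 * (FFE x u v * FFG x u v - FFF x u v ^ 2))

/-- The tangent map of the inversion at `p`. -/
def phiStar (c : E3) (r : ℝ) (p : E3) (w : E3) : E3 :=
  (r ^ 2 / ‖p - c‖ ^ 2) • w - (2 * r ^ 2 * ⟪p - c, w⟫ / ‖p - c‖ ^ 4) • (p - c)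

theorem cross_phiStar (c : E3) (r : ℝ) {p : E3} (hp : p ≠ c) (a b : E3) :
    cross (phiStar c r p a) (phiStar c r p b) =
      -(r ^ 4 / ‖p - c‖ ^ 4) •
        (cross a b - (2 * ⟪cross a b, p - c⟫ / ‖p - c‖ ^ 2) • (p - c)) := by
  have hq : ‖p - c‖ ^ 2 ≠ 0 := pow_ne_zero 2 (norm_ne_zero_iff.2 (sub_ne_zero.2 hp))
  unfold phiStar
  generalize p - c = d at *
  have hd : ‖d‖ ^ 2 = d 0 ^ 2 + d 1 ^ 2 + d 2 ^ 2 := by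
    simp [EuclideanSpace.norm_sq_eq, Fin.sum_univ_three]
  have h4 : ‖d‖ ^ 4 = (‖d‖ ^ 2) ^ 2 := by ring
  rw [h4]
  rw [hd] at hq ⊢
  ext i
  fin_cases i <;>
    · simp [cross, PiLp.inner_apply, Fin.sum_univ_three]
      field_simp
      ring

theorem inner_cross_left (a b : E3) : ⟪a, cross a b⟫ = 0 := by
  simp [cross, PiLp.inner_apply, Fin.sum_univ_three]
  ring

theorem inner_cross_right (a b : E3) : ⟪b, cross a b⟫ = 0 := by
  simp [cross, PiLp.inner_apply, Fin.sum_univ_three]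
  ring

theorem sub_reflection_ne_zero {N d : E3} (hN : N ≠ 0) :
    N - (2 * ⟪N, d⟫ / ‖d‖ ^ 2) • d ≠ 0 := by
  intro h
  rcases eq_or_ne d 0 with rfl | hd
  · simp [hN] at h
  have hd' : ‖d‖ ≠ 0 := norm_ne_zero_iff.2 hd
  have h' := congrArg (fun z => ⟪z, d⟫) h
  simp only [inner_sub_left, real_inner_smul_left, real_inner_self_eq_norm_sq,
    inner_zero_left] at h'
  field_simp at h'
  have h0 : ⟪N, d⟫ = 0 := by linarith
  simp [h0, hN] at h

/-- The derivative of `t ↦ phiStar c r (γ t) (w t)` at a point where `γ` and `w` have the values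
`p` and `b` and the derivatives `a` and `s`. -/
def phiStarDeriv (c : E3) (r : ℝ) (p a b s : E3) : E3 :=
  phiStar c r p s - (2 * r ^ 2 * ⟪p - c, a⟫ / ‖p - c‖ ^ 4) • b -
    ((2 * r ^ 2 * ⟪a, b⟫ / ‖p - c‖ ^ 4
      - 8 * r ^ 2 * ⟪p - c, a⟫ * ⟪p - c, b⟫ / ‖p - c‖ ^ 6) • (p - c) +
    (2 * r ^ 2 * ⟪p - c, b⟫ / ‖p - c‖ ^ 4) • a)

theorem inner_phiStarDeriv (c : E3) (r : ℝ) {p : E3} (hp : p ≠ c) {a b N : E3} (s : E3)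
    (ha : ⟪a, N⟫ = 0) (hb : ⟪b, N⟫ = 0) :
    ⟪phiStarDeriv c r p a b s, N - (2 * ⟪N, p - c⟫ / ‖p - c‖ ^ 2) • (p - c)⟫ =
      r ^ 2 / ‖p - c‖ ^ 2 * (⟪s, N⟫ + 2 * ⟪N, p - c⟫ / ‖p - c‖ ^ 2 * ⟪a, b⟫) := by
  have hq : ‖p - c‖ ≠ 0 := norm_ne_zero_iff.2 (sub_ne_zero.2 hp)
  unfold phiStarDeriv phiStar
  generalize p - c = d at *
  simp only [inner_sub_left, inner_sub_right, inner_add_left, real_inner_smul_left,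
    real_inner_smul_right, real_inner_self_eq_norm_sq, ha, hb, real_inner_comm d a,
    real_inner_comm d b, real_inner_comm d s, real_inner_comm d N]
  field_simp
  ring

theorem hasDerivAt_norm_sub_sq {c : E3} {γ : ℝ → E3} {γ' : E3} {t : ℝ}
    (h : HasDerivAt γ γ' t) :
    HasDerivAt (fun t => ‖γ t - c‖ ^ 2) (2 * ⟪γ t - c, γ'⟫) t :=
  (h.sub_const c).norm_sq

theorem hasDerivAt_inv3 {c : E3} (r : ℝ) {γ : ℝ → E3} {γ' : E3} {t : ℝ}
    (h : HasDerivAt γ γ' t) (hc : γ t ≠ c) :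
    HasDerivAt (fun t => inv3 c r (γ t)) (phiStar c r (γ t) γ') t := by
  have hq : ‖γ t - c‖ ≠ 0 := norm_ne_zero_iff.2 (sub_ne_zero.2 hc)
  have hD := ((((hasDerivAt_const t (r ^ 2)).div (hasDerivAt_norm_sub_sq (c := c) h)
    (pow_ne_zero 2 hq)).smul (h.sub_const c)).const_add c)
  refine hD.congr_deriv ?_
  simp only [phiStar, sub_eq_add_neg (_ • γ'), ← neg_smul, Pi.div_apply]
  congr 2
  field_simp
  ring

theorem hasDerivAt_phiStar {c : E3} (r : ℝ) {γ w : ℝ → E3} {γ' w' : E3} {t : ℝ}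
    (h : HasDerivAt γ γ' t) (hw : HasDerivAt w w' t) (hc : γ t ≠ c) :
    HasDerivAt (fun t => phiStar c r (γ t) (w t))
      (phiStarDeriv c r (γ t) γ' (w t) w') t := by
  have hq : ‖γ t - c‖ ≠ 0 := norm_ne_zero_iff.2 (sub_ne_zero.2 hc)
  have hn := hasDerivAt_norm_sub_sq (c := c) h
  have hd := h.sub_const c
  have hn4 : HasDerivAt (fun t => ‖γ t - c‖ ^ 4) (4 * ‖γ t - c‖ ^ 2 * ⟪γ t - c, γ'⟫) t := by
    have := hn.pow 2
    refine (this.congr_deriv ?_).congr_of_eventuallyEq (.of_forall fun s => ?_)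
    · simp; ring
    · simp [← pow_mul]
  have hD := (((hasDerivAt_const t (r ^ 2)).div hn (pow_ne_zero 2 hq)).smul hw).sub
    ((((hd.inner ℝ hw).const_mul (2 * r ^ 2)).div hn4 (pow_ne_zero 4 hq)).smul hd)
  refine hD.congr_deriv ?_
  simp only [phiStarDeriv, phiStar, Pi.div_apply]
  generalize γ t - c = d at *
  match_scalars <;> field_simp <;> ring

theorem ContDiff.uncurry_pu {x : ℝ → ℝ → E3}
    (hx : ContDiff ℝ (⊤ : ℕ∞) (fun p : ℝ × ℝ => x p.1 p.2)) :
    ContDiff ℝ (⊤ : ℕ∞) (fun p : ℝ × ℝ => pu x p.1 p.2) := by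
  have h : (fun p : ℝ × ℝ => pu x p.1 p.2) =
      fun p => fderiv ℝ (fun p : ℝ × ℝ => x p.1 p.2) p (1, 0) := by
    ext1 p
    have h1 := (hx.differentiable (by simp) (p.1, p.2)).hasFDerivAt.comp_hasDerivAt p.1
      ((hasDerivAt_id p.1).prodMk (hasDerivAt_const p.1 p.2))
    exact h1.deriv
  rw [h]
  exact (hx.fderiv_right (by simp)).clm_apply contDiff_const

theorem ContDiff.uncurry_pv {x : ℝ → ℝ → E3}
    (hx : ContDiff ℝ (⊤ : ℕ∞) (fun p : ℝ × ℝ => x p.1 p.2)) :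
    ContDiff ℝ (⊤ : ℕ∞) (fun p : ℝ × ℝ => pv x p.1 p.2) := by
  have hswap : ContDiff ℝ (⊤ : ℕ∞) (fun p : ℝ × ℝ => x p.2 p.1) :=
    hx.comp (contDiff_snd.prodMk contDiff_fst)
  exact (ContDiff.uncurry_pu (x := fun v u => x u v) hswap).comp
    (contDiff_snd.prodMk contDiff_fst)

theorem ContDiff.hasDerivAt_pu {x : ℝ → ℝ → E3}
    (hx : ContDiff ℝ (⊤ : ℕ∞) (fun p : ℝ × ℝ => x p.1 p.2)) (u v : ℝ) :
    HasDerivAt (fun t => x t v) (pu x u v) u :=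
  ((hx.comp (contDiff_id.prodMk contDiff_const)).differentiable (by simp) u).hasDerivAt

theorem ContDiff.hasDerivAt_pv {x : ℝ → ℝ → E3}
    (hx : ContDiff ℝ (⊤ : ℕ∞) (fun p : ℝ × ℝ => x p.1 p.2)) (u v : ℝ) :
    HasDerivAt (fun t => x u t) (pv x u v) v :=
  ((hx.comp (contDiff_const.prodMk contDiff_id)).differentiable (by simp) v).hasDerivAt

/-- The second fundamental form of the inverse patch is, up to a common nonzero factor, that of the
original patch plus `2 η / ‖x - c‖²` times its first fundamental form. -/
theorem exists_secondForm_inv3 {c : E3} {r : ℝ} (hr : 0 < r) {x y : ℝ → ℝ → E3}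
    (hx : ContDiff ℝ (⊤ : ℕ∞) (fun p : ℝ × ℝ => x p.1 p.2)) (hxc : ∀ u v : ℝ, x u v ≠ c)
    (hy : ∀ u v : ℝ, y u v = inv3 c r (x u v)) {u v : ℝ}
    (hreg : cross (pu x u v) (pv x u v) ≠ 0) :
    ∃ k : ℝ, k ≠ 0 ∧
      SFe y u v = k * (SFe x u v + 2 * eta c x u v / ‖x u v - c‖ ^ 2 * FFE x u v) ∧
      SFf y u v = k * (SFf x u v + 2 * eta c x u v / ‖x u v - c‖ ^ 2 * FFF x u v) ∧
      SFg y u v = k * (SFg x u v + 2 * eta c x u v / ‖x u v - c‖ ^ 2 * FFG x u v) := by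
  have hpu : pu y = fun u v => phiStar c r (x u v) (pu x u v) := by
    ext1 u; ext1 v
    simpa only [pu, hy] using (hasDerivAt_inv3 r (hx.hasDerivAt_pu u v) (hxc u v)).deriv
  have hpv : pv y = fun u v => phiStar c r (x u v) (pv x u v) := by
    ext1 u; ext1 v
    simpa only [pv, hy] using (hasDerivAt_inv3 r (hx.hasDerivAt_pv u v) (hxc u v)).deriv
  have huu : pu (pu y) u v =
      phiStarDeriv c r (x u v) (pu x u v) (pu x u v) (pu (pu x) u v) := by
    rw [hpu]
    exact (hasDerivAt_phiStar r (hx.hasDerivAt_pu u v)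
      (hx.uncurry_pu.hasDerivAt_pu u v) (hxc u v)).deriv
  have huv : pv (pu y) u v =
      phiStarDeriv c r (x u v) (pv x u v) (pu x u v) (pv (pu x) u v) := by
    rw [hpu]
    exact (hasDerivAt_phiStar r (hx.hasDerivAt_pv u v)
      (hx.uncurry_pu.hasDerivAt_pv u v) (hxc u v)).deriv
  have hvv : pv (pv y) u v =
      phiStarDeriv c r (x u v) (pv x u v) (pv x u v) (pv (pv x) u v) := by
    rw [hpv]
    exact (hasDerivAt_phiStar r (hx.hasDerivAt_pv u v)
      (hx.uncurry_pv.hasDerivAt_pv u v) (hxc u v)).deriv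
  have hq : ‖x u v - c‖ ≠ 0 := norm_ne_zero_iff.2 (sub_ne_zero.2 (hxc u v))
  have hcross := cross_phiStar c r (hxc u v) (pu x u v) (pv x u v)
  have hN := norm_ne_zero_iff.2 hreg
  have hcy : cross (pu y u v) (pv y u v) ≠ 0 := by
    rw [hpu, hpv, hcross]
    exact smul_ne_zero (neg_ne_zero.2 (by positivity)) (sub_reflection_ne_zero hreg)
  have hUx : unormal x u v = ‖cross (pu x u v) (pv x u v)‖⁻¹ • cross (pu x u v) (pv x u v) := rfl
  have hUy : unormal y u v = ‖cross (pu y u v) (pv y u v)‖⁻¹ •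
      -(r ^ 4 / ‖x u v - c‖ ^ 4) • (cross (pu x u v) (pv x u v) -
        (2 * ⟪cross (pu x u v) (pv x u v), x u v - c⟫ / ‖x u v - c‖ ^ 2) • (x u v - c)) := by
    rw [← hcross, unormal, hpu, hpv]
  have hcy' := norm_ne_zero_iff.2 hcy
  have hul := inner_cross_left (pu x u v) (pv x u v)
  have hvl := inner_cross_right (pu x u v) (pv x u v)
  refine ⟨‖cross (pu y u v) (pv y u v)‖⁻¹ * -(r ^ 4 / ‖x u v - c‖ ^ 4) *
    (r ^ 2 / ‖x u v - c‖ ^ 2) * ‖cross (pu x u v) (pv x u v)‖, ?_, ?_, ?_, ?_⟩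
  · have := hr.ne'
    simp [hcy', hN, hq, this]
  all_goals
    simp only [SFe, SFf, SFg, eta, FFE, FFF, FFG, huu, huv, hvv, hUy, hUx,
      real_inner_smul_left, real_inner_smul_right]
    rw [inner_phiStarDeriv c r (hxc u v) _ (by assumption) (by assumption)]
    try rw [real_inner_comm (pu x u v) (pv x u v)]
    field_simp

theorem conjugate_vectors_invariant_iff
    (c : E3) (r : ℝ) (hr : 0 < r)
    (x : ℝ → ℝ → E3)
    (hx : ContDiff ℝ (⊤ : ℕ∞) (fun p : ℝ × ℝ => x p.1 p.2))
    (hxc : ∀ u v : ℝ, x u v ≠ c)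
    (y : ℝ → ℝ → E3) (hy : ∀ u v : ℝ, y u v = inv3 c r (x u v))
    (hreg : ∀ u v : ℝ, cross (pu x u v) (pv x u v) ≠ 0)
    (u₀ v₀ : ℝ) (a₁ b₁ a₂ b₂ : ℝ)
    (h₁ : (a₁, b₁) ≠ (0, 0)) (h₂ : (a₂, b₂) ≠ (0, 0))
    (hconj : SFe x u₀ v₀ * (a₁ * a₂) + SFf x u₀ v₀ * (a₁ * b₂ + a₂ * b₁) +
        SFg x u₀ v₀ * (b₁ * b₂) = 0) :
    (SFe y u₀ v₀ * (a₁ * a₂) + SFf y u₀ v₀ * (a₁ * b₂ + a₂ * b₁) +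
        SFg y u₀ v₀ * (b₁ * b₂) = 0) ↔
      (eta c x u₀ v₀ = 0 ∨
        FFE x u₀ v₀ * (a₁ * a₂) + FFF x u₀ v₀ * (a₁ * b₂ + a₂ * b₁) +
          FFG x u₀ v₀ * (b₁ * b₂) = 0) := by
  obtain ⟨k, hk, he, hf, hg⟩ := exists_secondForm_inv3 hr hx hxc hy (hreg u₀ v₀)
  have hq : ‖x u₀ v₀ - c‖ ≠ 0 := norm_ne_zero_iff.2 (sub_ne_zero.2 (hxc u₀ v₀))
  have key : SFe y u₀ v₀ * (a₁ * a₂) + SFf y u₀ v₀ * (a₁ * b₂ + a₂ * b₁) +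
      SFg y u₀ v₀ * (b₁ * b₂) = k * (2 / ‖x u₀ v₀ - c‖ ^ 2) * (eta c x u₀ v₀ *
        (FFE x u₀ v₀ * (a₁ * a₂) + FFF x u₀ v₀ * (a₁ * b₂ + a₂ * b₁) +
          FFG x u₀ v₀ * (b₁ * b₂))) := by
    rw [he, hf, hg]
    linear_combination k * hconj
  have hk' : k * (2 / ‖x u₀ v₀ - c‖ ^ 2) ≠ 0 := mul_ne_zero hk (by positivity)
  rw [key, mul_eq_zero, or_iff_right hk', mul_eq_zero]
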